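/- Let X be a measurable space and let α be a probability measure on Multiset X (with the bag σ-algebra), i.e. a point process on X. Define the intensity measure 𝔼(α) = Measure.join (α.map i^B), the join of the pushforward of α along i^B : Multiset X → Measure X. Then for every measurable subset U of X, 𝔼(α)(U) = ∑_{k=1}^∞ k · α(A^U_k), i.e. the intensity measure of U is the expected number of points in U. -/

import Mathlib

open MeasureTheory
open scoped ENNReal

/-- `bagA U k` is the set `A^U_k` of bags with exactly `k` elements
(counted with multiplicity) lying in `U`. -/
def bagA {X : Type*} (U : Set X) (k : ℕ) : Set (Multiset X) :=
  {b | @Multiset.countP X (· ∈ U) (Classical.decPred _) b = k}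

/-- The bag σ-algebra on `Multiset X`, generated by the sets `A^U_k`
for `U` measurable and `k : ℕ`. -/
instance bagMeasurableSpace (X : Type*) [MeasurableSpace X] : MeasurableSpace (Multiset X) :=
  MeasurableSpace.generateFrom {A | ∃ (U : Set X) (k : ℕ), MeasurableSet U ∧ A = bagA U k}

/-- `iB` sends a bag to its counting measure, the multiplicity-respecting
sum of Dirac measures at its elements. -/
noncomputable def iB {X : Type*} [MeasurableSpace X] (b : Multiset X) : Measure X :=
  (b.map Measure.dirac).sum

/-- The number of points of a bag lying in `U`. -/
noncomputable def bagCount {X : Type*} (U : Set X) (b : Multiset X) : ℕ :=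
  @Multiset.countP X (· ∈ U) (Classical.decPred _) b

theorem measurable_bagCount {X : Type*} [MeasurableSpace X] {U : Set X} (hU : MeasurableSet U) :
    Measurable (bagCount U) :=
  measurable_to_countable' fun k => MeasurableSpace.measurableSet_generateFrom ⟨U, k, hU, rfl⟩

theorem iB_apply {X : Type*} [MeasurableSpace X] {U : Set X} (hU : MeasurableSet U)
    (b : Multiset X) : iB b U = bagCount U b := by
  classical
  induction b using Multiset.induction_on with
  | empty => simp [iB, bagCount]
  | cons a s ih =>
    have h : iB (a ::ₘ s) = Measure.dirac a + iB s := by simp [iB]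
    rw [h, Measure.add_apply, ih, Measure.dirac_apply' _ hU]
    by_cases ha : a ∈ U <;> simp [bagCount, ha, add_comm]

theorem measurable_iB {X : Type*} [MeasurableSpace X] :
    Measurable (iB : Multiset X → Measure X) := by
  refine Measure.measurable_of_measurable_coe _ fun U hU => ?_
  simp_rw [iB_apply hU]
  exact measurable_from_nat.comp (measurable_bagCount hU)

/-- The intensity measure `𝔼(α) = join (α.map i^B)` of a point process `α`
assigns to `U` the expected number of points in `U`: `∑ₖ k · α(A^U_k)`. -/
theorem intensity_eq_expected_count {X : Type*} [MeasurableSpace X]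
    (α : Measure (Multiset X)) [IsProbabilityMeasure α] {U : Set X} (hU : MeasurableSet U) :
    Measure.join (α.map iB) U = ∑' k : ℕ, (k : ℝ≥0∞) * α (bagA U k) := by
  have hc := measurable_bagCount hU
  rw [Measure.join_apply hU, lintegral_map (Measure.measurable_coe hU) measurable_iB]
  simp_rw [iB_apply hU]
  rw [← lintegral_map (f := fun n : ℕ => (n : ℝ≥0∞)) measurable_from_nat hc, lintegral_countable']
  refine tsum_congr fun k => ?_
  rw [Measure.map_apply hc (measurableSet_singleton k)]
  rfl
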